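/- There exist constants C > 0, δ > 0 and T₀ > 2 such that for all T ≥ T₀ and all real a with 0 < a ≤ δ the following holds: defining Λ_a(m) := −Λ(m)·m^{−a/log T} and f_a(n) := (Λ_a * Λ_a * τ)(n) = Σ_{d·m·ℓ = n} Λ_a(d)·Λ_a(m)·τ(ℓ) (sum over factorizations of n into positive integers d, m, ℓ), one has | Σ_{n ≤ T/(2π)} f_a(n) − (T(log T)³/(2π)) · (a − 2 + e^{−a}(a + 2))/a³ | ≤ C · T(log T)². -/

import Mathlib

open Real
open ArithmeticFunction (vonMangoldt)

/-- Grouping a sum over divisors of `n ≤ N` by the divisor. -/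
lemma sum_Ioc_sum_divisors (F : ℕ → ℕ → ℝ) (N : ℕ) :
    ∑ n ∈ Finset.Ioc 0 N, ∑ d ∈ n.divisors, F d (n / d) =
      ∑ d ∈ Finset.Ioc 0 N, ∑ k ∈ Finset.Ioc 0 (N / d), F d k := by
  rw [Finset.sum_sigma', Finset.sum_sigma']
  refine Finset.sum_bij' (fun p _ ↦ ⟨p.2, p.1 / p.2⟩) (fun p _ ↦ ⟨p.1 * p.2, p.1⟩) ?_ ?_ ?_ ?_ ?_
  · rintro ⟨n, d⟩ h
    simp only [Finset.mem_sigma, Finset.mem_Ioc, Nat.mem_divisors] at h ⊢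
    obtain ⟨⟨hn, hnN⟩, hd, -⟩ := h
    exact ⟨⟨Nat.pos_of_dvd_of_pos hd hn, (Nat.le_of_dvd hn hd).trans hnN⟩,
      Nat.div_pos (Nat.le_of_dvd hn hd) (Nat.pos_of_dvd_of_pos hd hn), Nat.div_le_div_right hnN⟩
  · rintro ⟨d, k⟩ h
    simp only [Finset.mem_sigma, Finset.mem_Ioc, Nat.mem_divisors] at h ⊢
    obtain ⟨⟨hd, hdN⟩, hk, hkN⟩ := h
    refine ⟨⟨Nat.mul_pos hd hk, ?_⟩, Dvd.intro _ rfl, (Nat.mul_pos hd hk).ne'⟩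
    rw [mul_comm]
    exact (Nat.le_div_iff_mul_le hd).1 hkN
  · rintro ⟨n, d⟩ h
    simp only [Finset.mem_sigma, Finset.mem_Ioc, Nat.mem_divisors] at h
    simp [Nat.mul_div_cancel' h.2.1]
  · rintro ⟨d, k⟩ h
    simp only [Finset.mem_sigma, Finset.mem_Ioc] at h
    simp [Nat.mul_div_cancel_left _ h.1.1]
  · intros; rfl

lemma abs_sum_card_divisors_sub_le {y : ℝ} (hy : 1 ≤ y) :
    |∑ n ∈ Finset.Ioc 0 ⌊y⌋₊, (n.divisors.card : ℝ) - y * log y| ≤ y := by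
  have hsum : ∑ n ∈ Finset.Ioc 0 ⌊y⌋₊, (n.divisors.card : ℝ) =
      ∑ k ∈ Finset.Ioc 0 ⌊y⌋₊, (⌊y / k⌋₊ : ℝ) := by
    simpa [Nat.floor_div_natCast] using sum_Ioc_sum_divisors (fun _ _ ↦ 1) ⌊y⌋₊
  have hharm : ((harmonic ⌊y⌋₊ : ℚ) : ℝ) = ∑ k ∈ Finset.Ioc 0 ⌊y⌋₊, (k : ℝ)⁻¹ := by
    rw [harmonic_eq_sum_Icc]
    push_cast
    rfl
  have hlow := log_le_harmonic_floor y (by linarith)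
  have hupp := harmonic_floor_le_one_add_log y hy
  rw [hharm] at hlow hupp
  have h1 : ∑ k ∈ Finset.Ioc 0 ⌊y⌋₊, (⌊y / k⌋₊ : ℝ) ≤ y * ∑ k ∈ Finset.Ioc 0 ⌊y⌋₊, (k : ℝ)⁻¹ := by
    rw [Finset.mul_sum]
    exact Finset.sum_le_sum fun k _ ↦ Nat.floor_le (by positivity)
  have h2 : y * ∑ k ∈ Finset.Ioc 0 ⌊y⌋₊, (k : ℝ)⁻¹ - y ≤
      ∑ k ∈ Finset.Ioc 0 ⌊y⌋₊, (⌊y / k⌋₊ : ℝ) := by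
    have h3 : ∑ k ∈ Finset.Ioc 0 ⌊y⌋₊, (y * (k : ℝ)⁻¹ - 1) ≤
        ∑ k ∈ Finset.Ioc 0 ⌊y⌋₊, (⌊y / k⌋₊ : ℝ) :=
      Finset.sum_le_sum fun k _ ↦ (Nat.sub_one_lt_floor (y / k)).le
    rw [Finset.sum_sub_distrib, ← Finset.mul_sum] at h3
    simp only [Finset.sum_const, Nat.card_Ioc, nsmul_eq_mul, mul_one, Nat.sub_zero] at h3
    linarith [Nat.floor_le (by linarith : 0 ≤ y)]
  rw [hsum, abs_le]
  constructor <;> nlinarith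

lemma log_factorial_eq_sum_vonMangoldt (N : ℕ) :
    log N.factorial = ∑ n ∈ Finset.Ioc 0 N, vonMangoldt n * (N / n : ℕ) := by
  rw [← ArithmeticFunction.sum_Ioc_mul_zeta_eq_sum, ArithmeticFunction.vonMangoldt_mul_zeta]
  induction N with
  | zero => simp
  | succ n ih =>
    rw [Finset.sum_Ioc_succ_top (by omega), ← ih, Nat.factorial_succ, Nat.cast_mul,
      log_mul (by positivity) (by positivity), ArithmeticFunction.log_apply]
    ring

/-- The first theorem of Mertens for the von Mangoldt function. -/
lemma abs_sum_vonMangoldt_div_sub_log_le {x : ℝ} (hx : 1 ≤ x) :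
    |∑ n ∈ Finset.Ioc 0 ⌊x⌋₊, vonMangoldt n / n - log x| ≤ log 4 + 4 := by
  set N := ⌊x⌋₊ with hN
  have hx0 : 0 < x := by linarith
  have hN1 : 1 ≤ N := (Nat.one_le_floor_iff _).2 hx
  have hN1' : (1 : ℝ) ≤ N := mod_cast hN1
  have hNx : (N : ℝ) ≤ x := Nat.floor_le hx0.le
  have hxN : x < N + 1 := Nat.lt_floor_add_one x
  have hlogx : 0 ≤ log x := log_nonneg hx
  have hfac := log_factorial_eq_sum_vonMangoldt N
  have hpsi := Chebyshev.psi_le_const_mul_self hx0.le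
  rw [Chebyshev.psi, ← hN] at hpsi
  have h1 : log N.factorial ≤ x * ∑ n ∈ Finset.Ioc 0 N, vonMangoldt n / n := by
    rw [hfac, Finset.mul_sum]
    refine Finset.sum_le_sum fun n _ ↦ ?_
    rw [hN, ← Nat.floor_div_natCast]
    calc vonMangoldt n * (⌊x / n⌋₊ : ℝ) ≤ vonMangoldt n * (x / n) :=
          mul_le_mul_of_nonneg_left (Nat.floor_le (by positivity))
            ArithmeticFunction.vonMangoldt_nonneg
      _ = _ := by ring
  have h2 : x * ∑ n ∈ Finset.Ioc 0 N, vonMangoldt n / n - ∑ n ∈ Finset.Ioc 0 N, vonMangoldt n ≤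
      log N.factorial := by
    rw [hfac, Finset.mul_sum, ← Finset.sum_sub_distrib]
    refine Finset.sum_le_sum fun n _ ↦ ?_
    rw [hN, ← Nat.floor_div_natCast]
    calc x * (vonMangoldt n / n) - vonMangoldt n = vonMangoldt n * (x / n - 1) := by ring
      _ ≤ _ := mul_le_mul_of_nonneg_left (Nat.sub_one_lt_floor _).le
            ArithmeticFunction.vonMangoldt_nonneg
  have h3 : log N.factorial ≤ x * log x := by
    calc log N.factorial ≤ log ((N : ℝ) ^ N) :=
          log_le_log (by positivity) (mod_cast Nat.factorial_le_pow N)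
      _ = N * log N := log_pow _ _
      _ ≤ x * log x := by gcongr
  have h4 : x * log x - 2 * x ≤ log N.factorial := by
    have hst := Stirling.le_log_factorial_stirling (n := N) (by omega)
    have hlogN : 0 ≤ log N := log_nonneg hN1'
    have hpi : 0 ≤ log (2 * π) := log_nonneg (by linarith [pi_gt_three])
    have hdiv : log x - log N ≤ x / N - 1 := by
      rw [← log_div hx0.ne' (by positivity)]
      exact log_le_sub_one_of_pos (by positivity)
    have hmul : N * (log x - log N) ≤ x - N := by
      calc N * (log x - log N) ≤ N * (x / N - 1) := by gcongr
        _ = x - N := by field_simp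
    have hlog := log_le_sub_one_of_pos hx0
    nlinarith
  have hlog4 : 0 ≤ log 4 := log_nonneg (by norm_num)
  rw [abs_le]
  constructor
  · refine le_of_mul_le_mul_left ?_ hx0
    nlinarith
  · refine le_of_mul_le_mul_left ?_ hx0
    nlinarith

/-- Partial summation against a sequence whose summatory function is `log t + O(1)`. -/
lemma abs_sum_mul_comp_log_sub_le {c : ℕ → ℝ} {K B Y : ℝ} {g g' H : ℝ → ℝ} (hc : c 0 = 0)
    (hK : ∀ t : ℝ, 1 ≤ t → |∑ k ∈ Finset.Ioc 0 ⌊t⌋₊, c k - log t| ≤ K) (hY : 0 ≤ Y)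
    (hg : ∀ v, HasDerivAt g (g' v) v) (hg' : Continuous g') (hH : ∀ v, HasDerivAt H (g v) v)
    (hgY : g Y = 0) (hB : ∀ v ∈ Set.Icc 0 Y, |g' v| ≤ B) :
    |∑ k ∈ Finset.Ioc 0 ⌊exp Y⌋₊, c k * g (log k) - (H Y - H 0)| ≤ K * B * Y := by
  have hu : (1 : ℝ) ≤ exp Y := one_le_exp hY
  have hIcc (t : ℝ) : ∑ k ∈ Finset.Icc 0 ⌊t⌋₊, c k = ∑ k ∈ Finset.Ioc 0 ⌊t⌋₊, c k := by
    rw [← Finset.add_sum_Ioc_eq_sum_Icc (Nat.zero_le _), hc, zero_add]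
  have hd (t : ℝ) (ht : t ∈ Set.Icc 1 (exp Y)) :
      HasDerivAt (fun t ↦ g (log t)) (g' (log t) * t⁻¹) t :=
    (hg (log t)).comp t (hasDerivAt_log (by linarith [ht.1]))
  have hcont : ContinuousOn (fun t ↦ g' (log t) * t⁻¹) (Set.Icc 1 (exp Y)) := by
    have hne : ∀ t ∈ Set.Icc 1 (exp Y), t ≠ 0 := fun t ht ↦ by linarith [ht.1]
    exact (hg'.comp_continuousOn (continuousOn_log.mono fun t ht ↦ hne t ht)).mul
      (continuousOn_inv₀.mono fun t ht ↦ hne t ht)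
  have hint : MeasureTheory.IntegrableOn (fun t ↦ g' (log t) * t⁻¹) (Set.Icc 1 (exp Y)) :=
    hcont.integrableOn_Icc
  have hderiv : Set.EqOn (deriv fun t ↦ g (log t)) (fun t ↦ g' (log t) * t⁻¹)
      (Set.Icc 1 (exp Y)) := fun t ht ↦ (hd t ht).deriv
  have habel := sum_mul_eq_sub_integral_mul₀ (f := fun t ↦ g (log t)) c hc (exp Y)
    (fun t ht ↦ (hd t ht).differentiableAt)
    (hint.congr_fun hderiv.symm measurableSet_Icc)
  rw [← Finset.add_sum_Ioc_eq_sum_Icc (Nat.zero_le _), hc, mul_zero, zero_add] at habel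
  simp only [log_exp, hgY, zero_mul, zero_sub] at habel
  have habel' : ∑ k ∈ Finset.Ioc 0 ⌊exp Y⌋₊, c k * g (log k) =
      -∫ t in (1 : ℝ)..exp Y, (g' (log t) * t⁻¹) * ∑ k ∈ Finset.Icc 0 ⌊t⌋₊, c k := by
    have hcongr : Set.EqOn
        (fun t ↦ deriv (fun t ↦ g (log t)) t * ∑ k ∈ Finset.Icc 0 ⌊t⌋₊, c k)
        (fun t ↦ (g' (log t) * t⁻¹) * ∑ k ∈ Finset.Icc 0 ⌊t⌋₊, c k) (Set.Ioc 1 (exp Y)) :=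
      fun t ht ↦ congrArg (· * _) (hderiv (Set.Ioc_subset_Icc_self ht))
    rw [intervalIntegral.integral_of_le hu,
      ← MeasureTheory.setIntegral_congr_fun measurableSet_Ioc hcongr, ← habel]
    exact Finset.sum_congr rfl fun _ _ ↦ mul_comm _ _
  have hparts : ∫ t in (1 : ℝ)..exp Y, (g' (log t) * t⁻¹) * log t = -(H Y - H 0) := by
    have hprim (t : ℝ) (ht : t ∈ Set.uIcc 1 (exp Y)) :
        HasDerivAt (fun t ↦ g (log t) * log t - H (log t)) ((g' (log t) * t⁻¹) * log t) t := by
      rw [Set.uIcc_of_le hu] at ht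
      have hlog := hasDerivAt_log (by linarith [ht.1] : t ≠ 0)
      exact (((hd t ht).mul hlog).sub ((hH (log t)).comp t hlog)).congr_deriv (by ring)
    rw [intervalIntegral.integral_eq_sub_of_hasDerivAt hprim]
    · simp only [log_exp, hgY, log_one]
      ring
    · apply ContinuousOn.intervalIntegrable
      rw [Set.uIcc_of_le hu]
      exact hcont.mul (continuousOn_log.mono fun t ht ↦ by
        simpa using (by linarith [ht.1] : t ≠ 0))
  have hi1 : IntervalIntegrable (fun t ↦ (g' (log t) * t⁻¹) * ∑ k ∈ Finset.Icc 0 ⌊t⌋₊, c k)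
      MeasureTheory.volume 1 (exp Y) := by
    rw [intervalIntegrable_iff_integrableOn_Icc_of_le hu]
    exact integrableOn_mul_sum_Icc c zero_le_one hint
  have hi2 : IntervalIntegrable (fun t ↦ (g' (log t) * t⁻¹) * log t)
      MeasureTheory.volume 1 (exp Y) := by
    apply ContinuousOn.intervalIntegrable
    rw [Set.uIcc_of_le hu]
    exact hcont.mul (continuousOn_log.mono fun t ht ↦ by
      simpa using (by linarith [ht.1] : t ≠ 0))
  have hinv : ∫ t in (1 : ℝ)..exp Y, K * B * t⁻¹ = K * B * Y := by
    rw [intervalIntegral.integral_const_mul, integral_inv_of_pos one_pos (exp_pos Y), div_one,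
      log_exp]
  rw [habel', ← neg_eq_iff_eq_neg.2 hparts, sub_neg_eq_add, neg_add_eq_sub,
    ← intervalIntegral.integral_sub hi2 hi1, ← Real.norm_eq_abs, ← hinv]
  refine intervalIntegral.norm_integral_le_of_norm_le hu (.of_forall fun t ht ↦ ?_) ?_
  · have ht1 : 1 ≤ t := ht.1.le
    have hlt : log t ∈ Set.Icc 0 Y :=
      ⟨log_nonneg ht1, by simpa using log_le_log (by linarith) ht.2⟩
    have hb := hB _ hlt
    have hk := hK t ht1
    rw [hIcc, ← mul_sub, norm_mul, norm_mul, Real.norm_eq_abs, Real.norm_eq_abs, Real.norm_eq_abs,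
      abs_sub_comm, abs_of_pos (by positivity : 0 < t⁻¹)]
    calc |g' (log t)| * t⁻¹ * |∑ k ∈ Finset.Ioc 0 ⌊t⌋₊, c k - log t| ≤ B * t⁻¹ * K := by
          gcongr
          exact mul_nonneg ((abs_nonneg _).trans hb) (by positivity)
      _ = K * B * t⁻¹ := by ring
  · apply ContinuousOn.intervalIntegrable
    rw [Set.uIcc_of_le hu]
    exact continuousOn_const.mul (continuousOn_inv₀.mono fun t ht ↦ by
      simpa using (by linarith [ht.1] : t ≠ 0))

/-- The value of `∫ v in 0..X, v * (X - v) * exp (-s * v)` for `s ≠ 0`. -/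
noncomputable def laplaceMoment (s X : ℝ) : ℝ :=
  (s * X * exp (-(s * X)) + 2 * exp (-(s * X)) - 2 + s * X) / s ^ 3

lemma hasDerivAt_exp_neg_mul (s v : ℝ) :
    HasDerivAt (fun v ↦ exp (-(s * v))) (-s * exp (-(s * v))) v :=
  ((hasDerivAt_id v).const_mul s).neg.exp.congr_deriv (by simp; ring)

lemma abs_laplaceMoment_sub_le {s X L : ℝ} (hs : 0 < s) (hX : 0 ≤ X) (hXL : X ≤ L) :
    |laplaceMoment s L - laplaceMoment s X| ≤ L ^ 2 * (L - X) := by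
  have hd (v : ℝ) : HasDerivAt (laplaceMoment s) ((1 - exp (-(s * v)) * (1 + s * v)) / s ^ 2) v := by
    have he := hasDerivAt_exp_neg_mul s v
    have hv := (hasDerivAt_id v).const_mul s
    refine (((((hv.mul he).add (he.const_mul 2)).sub_const 2).add hv).div_const
      (s ^ 3)).congr_deriv ?_
    simp only [id]
    field_simp
    ring
  have hb (v : ℝ) (hv : v ∈ Set.Icc X L) :
      ‖(1 - exp (-(s * v)) * (1 + s * v)) / s ^ 2‖ ≤ L ^ 2 := by
    have hv0 : 0 ≤ v := hX.trans hv.1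
    have hsv : 0 ≤ s * v := by positivity
    have h1 : 1 - s * v ≤ exp (-(s * v)) := by linarith [add_one_le_exp (-(s * v))]
    have h2 : exp (-(s * v)) * (1 + s * v) ≤ 1 := by
      calc exp (-(s * v)) * (1 + s * v) ≤ exp (-(s * v)) * exp (s * v) := by
            gcongr
            linarith [add_one_le_exp (s * v)]
        _ = 1 := by rw [← exp_add]; simp
    rw [Real.norm_eq_abs, abs_of_nonneg (div_nonneg (by linarith) (by positivity)),
      div_le_iff₀ (by positivity)]
    calc 1 - exp (-(s * v)) * (1 + s * v) ≤ 1 - (1 - s * v) * (1 + s * v) := by gcongr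
      _ = v ^ 2 * s ^ 2 := by ring
      _ ≤ L ^ 2 * s ^ 2 := by
        have := hv.2
        gcongr
  have := (convex_Icc X L).norm_image_sub_le_of_norm_hasDerivWithin_le
    (fun v _ ↦ (hd v).hasDerivWithinAt) hb (Set.left_mem_Icc.2 hXL) (Set.right_mem_Icc.2 hXL)
  rwa [Real.norm_eq_abs, Real.norm_eq_abs, abs_of_nonneg (sub_nonneg.2 hXL)] at this

lemma abs_sum_sum_sub_laplaceMoment_le {c : ℕ → ℝ} {K s X : ℝ} (hc : c 0 = 0)
    (hc0 : ∀ n, 0 ≤ c n) (hK : ∀ t : ℝ, 1 ≤ t → |∑ k ∈ Finset.Ioc 0 ⌊t⌋₊, c k - log t| ≤ K)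
    (hs : 0 < s) (hX : 0 ≤ X) :
    |∑ d ∈ Finset.Ioc 0 ⌊exp X⌋₊, c d * ∑ m ∈ Finset.Ioc 0 (⌊exp X⌋₊ / d),
        c m * (exp (-(s * (log d + log m))) * (X - (log d + log m))) - laplaceMoment s X| ≤
      K * (1 + s * X) * X * ∑ d ∈ Finset.Ioc 0 ⌊exp X⌋₊, c d + K * X * X := by
  have hK0 : 0 ≤ K := (abs_nonneg _).trans (hK 1 le_rfl)
  set g : ℝ → ℝ := fun v ↦ exp (-(s * v)) * (X - v) with hg_def
  set g' : ℝ → ℝ := fun v ↦ -(exp (-(s * v)) * (1 + s * (X - v))) with hg'_def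
  set P : ℝ → ℝ := fun v ↦ exp (-(s * v)) * (v / s + (1 / s ^ 2 - X / s)) with hP_def
  set Q : ℝ → ℝ := fun v ↦ P X * v + exp (-(s * v)) * (v / s ^ 2 + (2 / s ^ 3 - X / s ^ 2))
    with hQ_def
  have hg (v : ℝ) : HasDerivAt g (g' v) v := by
    refine ((hasDerivAt_exp_neg_mul s v).mul ((hasDerivAt_id v).const_sub X)).congr_deriv ?_
    simp only [hg'_def, id]
    ring
  have hP (v : ℝ) : HasDerivAt P (g v) v := by
    refine ((hasDerivAt_exp_neg_mul s v).mul
      (((hasDerivAt_id v).div_const s).add_const _)).congr_deriv ?_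
    simp only [hg_def, id]
    field_simp
    ring
  have hQ (v : ℝ) : HasDerivAt Q (P X - P v) v := by
    refine (((hasDerivAt_id v).const_mul (P X)).add ((hasDerivAt_exp_neg_mul s v).mul
      (((hasDerivAt_id v).div_const (s ^ 2)).add_const _))).congr_deriv ?_
    simp only [hP_def, id]
    field_simp
    ring
  have hQX : Q X - Q 0 = laplaceMoment s X := by
    simp only [hQ_def, hP_def, laplaceMoment, mul_zero, neg_zero, exp_zero]
    field_simp
    ring
  have hexp (v : ℝ) (hv : 0 ≤ v) : exp (-(s * v)) ≤ 1 :=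
    exp_le_one_iff.2 (neg_nonpos.2 (by positivity))
  have hinner (d : ℕ) (hd : d ∈ Finset.Ioc 0 ⌊exp X⌋₊) :
      |∑ m ∈ Finset.Ioc 0 (⌊exp X⌋₊ / d), c m * g (log d + log m) - (P X - P (log d))| ≤
        K * (1 + s * X) * X := by
    rw [Finset.mem_Ioc] at hd
    have hd0 : (0 : ℝ) < d := mod_cast hd.1
    have hld : 0 ≤ log d := log_natCast_nonneg d
    have hdX : log d ≤ X := by
      rw [log_le_iff_le_exp hd0]
      exact (Nat.le_floor_iff (exp_pos X).le).1 hd.2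
    have hY : exp (X - log d) = exp X / d := by rw [exp_sub, exp_log hd0]
    have h := abs_sum_mul_comp_log_sub_le (g := fun v ↦ g (log d + v))
      (g' := fun v ↦ g' (log d + v)) (H := fun v ↦ P (log d + v)) (B := 1 + s * X) hc hK
      (sub_nonneg.2 hdX) (fun v ↦ (hg (log d + v)).comp_const_add (log d) v)
      (by simp only [hg'_def]; fun_prop) (fun v ↦ (hP (log d + v)).comp_const_add (log d) v)
      (by simp [hg_def]) ?_
    · rw [hY, Nat.floor_div_natCast] at h
      simp only [add_zero, add_sub_cancel] at h
      refine h.trans ?_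
      gcongr
      linarith
    · intro v hv
      have hv0 := hv.1
      have hvX : 0 ≤ X - (log d + v) := by linarith [hv.2]
      simp only [hg'_def, abs_neg]
      rw [abs_of_nonneg (by positivity)]
      calc exp (-(s * (log d + v))) * (1 + s * (X - (log d + v)))
          ≤ 1 * (1 + s * X) := by
            gcongr
            · exact hexp _ (by linarith)
            · linarith
        _ = 1 + s * X := one_mul _
  have houter : |∑ d ∈ Finset.Ioc 0 ⌊exp X⌋₊, c d * (P X - P (log d)) - laplaceMoment s X| ≤
      K * X * X := by
    rw [← hQX]
    refine abs_sum_mul_comp_log_sub_le (g := fun v ↦ P X - P v) (g' := fun v ↦ -g v) hc hK hX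
      (fun v ↦ (hP v).const_sub _) (by simp only [hg_def]; fun_prop) hQ (by simp) ?_
    intro v hv
    have hv0 := hv.1
    have hvX : 0 ≤ X - v := by linarith [hv.2]
    simp only [hg_def, abs_neg]
    rw [abs_of_nonneg (by positivity)]
    calc exp (-(s * v)) * (X - v) ≤ 1 * X := by
          gcongr
          · exact hexp _ hv0
          · linarith
      _ = X := one_mul X
  have hsub : |∑ d ∈ Finset.Ioc 0 ⌊exp X⌋₊, c d * ∑ m ∈ Finset.Ioc 0 (⌊exp X⌋₊ / d),
      c m * g (log d + log m) - ∑ d ∈ Finset.Ioc 0 ⌊exp X⌋₊, c d * (P X - P (log d))| ≤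
      K * (1 + s * X) * X * ∑ d ∈ Finset.Ioc 0 ⌊exp X⌋₊, c d := by
    rw [← Finset.sum_sub_distrib, Finset.mul_sum]
    refine (Finset.abs_sum_le_sum_abs _ _).trans (Finset.sum_le_sum fun d hd ↦ ?_)
    rw [← mul_sub, abs_mul, abs_of_nonneg (hc0 d), mul_comm]
    exact mul_le_mul_of_nonneg_right (hinner d hd) (hc0 d)
  exact (abs_sub_le _ _ _).trans (add_le_add hsub houter)

/-- The sum over `n ≤ exp X` of `Λ(d) d⁻ˢ Λ(m) m⁻ˢ τ(ℓ)` over `d * m * ℓ = n`, uniformly in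
`0 < s ≤ 1 / X`. -/
lemma exists_abs_sum_vonMangoldt_rpow_card_divisors_sub_le :
    ∃ C > (0 : ℝ), ∀ s X : ℝ, 0 < s → 1 ≤ X → s * X ≤ 1 →
      |∑ n ∈ Finset.Ioc 0 ⌊exp X⌋₊, ∑ d ∈ n.divisors, ∑ m ∈ (n / d).divisors,
          (-(vonMangoldt d) * (d : ℝ) ^ (-s)) * (-(vonMangoldt m) * (m : ℝ) ^ (-s)) *
            ((n / d / m).divisors.card : ℝ) - exp X * laplaceMoment s X| ≤
        C * exp X * X ^ 2 := by
  set K : ℝ := log 4 + 4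
  have hK0 : 0 < K := add_pos_of_nonneg_of_pos (log_nonneg (by norm_num)) (by norm_num)
  refine ⟨(1 + K) ^ 2 + 2 * K * (1 + K) + K, by positivity, fun s X hs hX hsX ↦ ?_⟩
  set c : ℕ → ℝ := fun n ↦ vonMangoldt n / n with hc_def
  have hc0 (n : ℕ) : 0 ≤ c n :=
    div_nonneg ArithmeticFunction.vonMangoldt_nonneg (Nat.cast_nonneg n)
  have hK (t : ℝ) (ht : 1 ≤ t) : |∑ k ∈ Finset.Ioc 0 ⌊t⌋₊, c k - log t| ≤ K :=
    abs_sum_vonMangoldt_div_sub_log_le ht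
  set N := ⌊exp X⌋₊ with hN
  set A := ∑ d ∈ Finset.Ioc 0 N, c d with hA_def
  have hA0 : 0 ≤ A := Finset.sum_nonneg fun d _ ↦ hc0 d
  have hA : A ≤ (1 + K) * X := by
    have := (abs_le.1 (hK (exp X) (one_le_exp (by linarith)))).2
    rw [log_exp, ← hN, ← hA_def] at this
    nlinarith
  have hmain := abs_sum_sum_sub_laplaceMoment_le (c := c) (by simp [hc_def]) hc0 hK hs
    (by linarith : 0 ≤ X)
  rw [← hN, ← hA_def] at hmain
  have hterm (d : ℕ) (hd : d ∈ Finset.Ioc 0 N) (m : ℕ) (hm : m ∈ Finset.Ioc 0 (N / d)) :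
      |∑ l ∈ Finset.Ioc 0 (N / d / m), (-(vonMangoldt d) * (d : ℝ) ^ (-s)) *
          (-(vonMangoldt m) * (m : ℝ) ^ (-s)) * (l.divisors.card : ℝ) -
        exp X * (c d * (c m * (exp (-(s * (log d + log m))) * (X - (log d + log m)))))| ≤
      exp X * (c d * c m) := by
    rw [Finset.mem_Ioc] at hd hm
    have hd0 : (0 : ℝ) < d := mod_cast hd.1
    have hm0 : (0 : ℝ) < m := mod_cast hm.1
    set y := exp X / d / m with hy_def
    have hfl : N / d / m = ⌊y⌋₊ := by rw [hy_def, Nat.floor_div_natCast, Nat.floor_div_natCast]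
    have hy : 1 ≤ y := by
      rw [hy_def, one_le_div hm0, ← Nat.le_floor_iff (by positivity), Nat.floor_div_natCast]
      exact hm.2
    have hlog : log y = X - (log d + log m) := by
      rw [hy_def, log_div (by positivity) hm0.ne', log_div (by positivity) hd0.ne', log_exp]
      ring
    have hpow : (d : ℝ) ^ (-s) * (m : ℝ) ^ (-s) = exp (-(s * (log d + log m))) := by
      rw [rpow_def_of_pos hd0, rpow_def_of_pos hm0, ← exp_add]
      ring_nf
    have hE : exp (-(s * (log d + log m))) ≤ 1 := by
      have := log_natCast_nonneg d
      have := log_natCast_nonneg m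
      exact exp_le_one_iff.2 (neg_nonpos.2 (by positivity))
    have hW : 0 ≤ vonMangoldt d * vonMangoldt m :=
      mul_nonneg ArithmeticFunction.vonMangoldt_nonneg ArithmeticFunction.vonMangoldt_nonneg
    have hWE := mul_nonneg hW (exp_pos (-(s * (log d + log m)))).le
    have hcc : exp X * (c d * c m) = vonMangoldt d * vonMangoldt m * y := by
      simp only [hc_def, hy_def]
      field_simp
    rw [← Finset.mul_sum, hfl, hcc]
    calc _ = |vonMangoldt d * vonMangoldt m * exp (-(s * (log d + log m))) *
            (∑ l ∈ Finset.Ioc 0 ⌊y⌋₊, (l.divisors.card : ℝ) - y * log y)| := by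
          congr 1
          rw [hlog, ← hpow]
          simp only [hc_def, hy_def]
          field_simp
      _ ≤ vonMangoldt d * vonMangoldt m * exp (-(s * (log d + log m))) * y := by
          rw [abs_mul, abs_of_nonneg hWE]
          exact mul_le_mul_of_nonneg_left (abs_sum_card_divisors_sub_le hy) hWE
      _ ≤ vonMangoldt d * vonMangoldt m * y :=
          mul_le_mul_of_nonneg_right (mul_le_of_le_one_right hW hE) (by linarith)
  have hreorder : ∑ n ∈ Finset.Ioc 0 N, ∑ d ∈ n.divisors, ∑ m ∈ (n / d).divisors,
      (-(vonMangoldt d) * (d : ℝ) ^ (-s)) * (-(vonMangoldt m) * (m : ℝ) ^ (-s)) *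
        ((n / d / m).divisors.card : ℝ) =
      ∑ d ∈ Finset.Ioc 0 N, ∑ m ∈ Finset.Ioc 0 (N / d), ∑ l ∈ Finset.Ioc 0 (N / d / m),
        (-(vonMangoldt d) * (d : ℝ) ^ (-s)) * (-(vonMangoldt m) * (m : ℝ) ^ (-s)) *
          (l.divisors.card : ℝ) := by
    rw [sum_Ioc_sum_divisors (fun d k ↦ ∑ m ∈ k.divisors, (-(vonMangoldt d) * (d : ℝ) ^ (-s)) *
      (-(vonMangoldt m) * (m : ℝ) ^ (-s)) * ((k / m).divisors.card : ℝ))]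
    exact Finset.sum_congr rfl fun d _ ↦ sum_Ioc_sum_divisors (fun m l ↦
      (-(vonMangoldt d) * (d : ℝ) ^ (-s)) * (-(vonMangoldt m) * (m : ℝ) ^ (-s)) *
        (l.divisors.card : ℝ)) (N / d)
  set M := ∑ d ∈ Finset.Ioc 0 N, c d * ∑ m ∈ Finset.Ioc 0 (N / d),
    c m * (exp (-(s * (log d + log m))) * (X - (log d + log m))) with hM_def
  have hdiv : |∑ d ∈ Finset.Ioc 0 N, ∑ m ∈ Finset.Ioc 0 (N / d), ∑ l ∈ Finset.Ioc 0 (N / d / m),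
      (-(vonMangoldt d) * (d : ℝ) ^ (-s)) * (-(vonMangoldt m) * (m : ℝ) ^ (-s)) *
        (l.divisors.card : ℝ) - exp X * M| ≤ exp X * (A * A) := by
    rw [hM_def, Finset.mul_sum, ← Finset.sum_sub_distrib, hA_def, Finset.sum_mul, Finset.mul_sum]
    refine (Finset.abs_sum_le_sum_abs _ _).trans (Finset.sum_le_sum fun d hd ↦ ?_)
    rw [Finset.mul_sum, Finset.mul_sum, ← Finset.sum_sub_distrib, Finset.mul_sum, Finset.mul_sum]
    refine (Finset.abs_sum_le_sum_abs _ _).trans ((Finset.sum_le_sum (hterm d hd)).trans ?_)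
    exact Finset.sum_le_sum_of_subset_of_nonneg
      (Finset.Ioc_subset_Ioc_right (Nat.div_le_self N d))
      fun m _ _ ↦ mul_nonneg (exp_pos X).le (mul_nonneg (hc0 d) (hc0 m))
  have hmain' : |exp X * M - exp X * laplaceMoment s X| ≤
      exp X * (K * (1 + s * X) * X * A + K * X * X) := by
    rw [← mul_sub, abs_mul, abs_of_pos (exp_pos X)]
    gcongr
  rw [hreorder]
  refine (abs_sub_le _ _ _).trans ((add_le_add hdiv hmain').trans ?_)
  calc exp X * (A * A) + exp X * (K * (1 + s * X) * X * A + K * X * X)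
      ≤ exp X * (((1 + K) * X) * ((1 + K) * X)) +
          exp X * (K * (1 + 1) * X * ((1 + K) * X) + K * X * X) := by gcongr
    _ = _ := by ring

/-- Mean value of `f(n) = (Λ_a * Λ_a * τ)(n)` with `Λ_a(m) = -Λ(m) m^{-a/log T}`:
`Σ_{n ≤ T/2π} f(n) = (T (log T)³/2π) (a-2+e^{-a}(a+2))/a³ + O(T (log T)²)`
(unconditional). -/
theorem mean_value_f :
    ∃ C > (0:ℝ), ∃ δ > (0:ℝ), ∃ T₀ > (2:ℝ), ∀ T, T₀ ≤ T → ∀ a : ℝ,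
      0 < a → a ≤ δ →
      |(∑ n ∈ Finset.Icc 1 ⌊T/(2*π)⌋₊, ∑ d ∈ n.divisors, ∑ m ∈ (n / d).divisors,
            (-(ArithmeticFunction.vonMangoldt d) * (d : ℝ) ^ (-(a / Real.log T)))
              * (-(ArithmeticFunction.vonMangoldt m) * (m : ℝ) ^ (-(a / Real.log T)))
              * ((n / d / m).divisors.card : ℝ))
          - T * Real.log T ^ 3 / (2*π) * ((a - 2 + Real.exp (-a) * (a + 2)) / a^3)|
        ≤ C * T * Real.log T ^ 2 := by
  obtain ⟨C, hC, h⟩ := exists_abs_sum_vonMangoldt_rpow_card_divisors_sub_le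
  have h2pi : 1 ≤ 2 * π := by linarith [pi_gt_three]
  have hlog2pi : 0 ≤ log (2 * π) := log_nonneg h2pi
  refine ⟨C + log (2 * π), by positivity, 1, one_pos, 100, by norm_num, fun T hT a ha ha1 ↦ ?_⟩
  have hT0 : 0 < T := by linarith
  have hx0 : 0 < T / (2 * π) := by positivity
  set L := log T with hL_def
  set X := log (T / (2 * π)) with hX_def
  have hXL : L - X = log (2 * π) := by
    rw [hX_def, log_div hT0.ne' (by positivity)]
    ring
  have hX : 1 ≤ X := by
    rw [hX_def, le_log_iff_exp_le hx0, le_div_iff₀ (by positivity)]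
    nlinarith [exp_one_lt_d9, pi_lt_four, pi_pos]
  have hL : 0 < L := by linarith
  have hs : 0 < a / L := by positivity
  have hsX : a / L * X ≤ 1 := by
    rw [div_mul_eq_mul_div, div_le_one hL]
    nlinarith
  have hmain := h (a / L) X hs hX hsX
  rw [hX_def, exp_log hx0, ← hX_def] at hmain
  have hmoment : T / (2 * π) * laplaceMoment (a / L) L =
      T * L ^ 3 / (2 * π) * ((a - 2 + exp (-a) * (a + 2)) / a ^ 3) := by
    rw [laplaceMoment, div_mul_cancel₀ a hL.ne']
    field_simp
    ring
  have hshift := abs_laplaceMoment_sub_le hs (by linarith : 0 ≤ X) (by linarith : X ≤ L)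
  rw [hXL, abs_sub_comm] at hshift
  have hxT : T / (2 * π) ≤ T := div_le_self hT0.le h2pi
  rw [← hmoment]
  refine (abs_sub_le _ _ _).trans ((add_le_add hmain (b := C * (T / (2 * π)) * X ^ 2)
    (d := T / (2 * π) * (L ^ 2 * log (2 * π))) ?_).trans ?_)
  · rw [← mul_sub, abs_mul, abs_of_pos hx0]
    gcongr
  · calc C * (T / (2 * π)) * X ^ 2 + T / (2 * π) * (L ^ 2 * log (2 * π))
        ≤ C * T * L ^ 2 + T * (L ^ 2 * log (2 * π)) := by
          gcongr
          linarith
      _ = _ := by ring
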